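/- arXiv:1012.1019 — 5 statements merged into one kernel-verified Lean document; each statement's English description precedes it below -/
import Mathlib

section
/- Let N and m be positive integers, let Z ∈ M_{2N}(ℂ) and Z′ ∈ M_{2m}(ℂ) be the matrices defining the dual operations on M_{2N}(ℂ) and M_{2m}(ℂ) respectively, and set U := (1/√2)(I − i Z ⊗ Z′) ∈ M_{4Nm}(ℂ). Then U is a unitary matrix with Uᵀ = U, and for all X ∈ M_{2N}(ℂ) and Y ∈ M_{2m}(ℂ) one has U† (X♯ ⊗ Y♯) U = (U† (X ⊗ Y) U)ᵀ, where the transpose on the right is the ordinary transpose of 4Nm×4Nm matrices. -/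
open Matrix
open scoped Kronecker ComplexOrder

/-- The 2N×2N matrix `Z = [[0, -I],[I, 0]]`. -/
noncomputable def Zmat (N : ℕ) : Matrix (Fin N ⊕ Fin N) (Fin N ⊕ Fin N) ℂ :=
  Matrix.fromBlocks 0 (-1) 1 0

/-- The dual `X♯ = -Z Xᵀ Z` of a 2N×2N complex matrix. -/
noncomputable def dual {N : ℕ} (X : Matrix (Fin N ⊕ Fin N) (Fin N ⊕ Fin N) ℂ) :
    Matrix (Fin N ⊕ Fin N) (Fin N ⊕ Fin N) ℂ :=
  -(Zmat N) * Xᵀ * (Zmat N)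

theorem Zmat_sq (N : ℕ) : Zmat N * Zmat N = -1 := by
  simp [Zmat, Matrix.fromBlocks_multiply, ← Matrix.fromBlocks_one, Matrix.fromBlocks_neg]

theorem Zmat_transpose (N : ℕ) : (Zmat N)ᵀ = -Zmat N := by
  simp [Zmat, Matrix.fromBlocks_transpose, Matrix.fromBlocks_neg]

theorem Zmat_conjTranspose (N : ℕ) : (Zmat N)ᴴ = -Zmat N := by
  simp [Zmat, Matrix.fromBlocks_conjTranspose, Matrix.fromBlocks_neg]

theorem neg_kron_neg {a b : Type*} (A : Matrix a a ℂ) (B : Matrix b b ℂ) :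
    (-A) ⊗ₖ (-B) = A ⊗ₖ B := by
  ext i j
  simp [Matrix.kroneckerMap_apply]

/-- With `U = (1/√2)(I - i Z ⊗ Z′)`, the matrix `U` is a symmetric unitary and
conjugation by `U` turns the tensor product of duals into the ordinary transpose:
`U† (X♯ ⊗ Y♯) U = (U† (X ⊗ Y) U)ᵀ`. -/
theorem dual_tensor_dual_eq_transpose (N m : ℕ) (hN : 0 < N) (hm : 0 < m)
    (U : Matrix ((Fin N ⊕ Fin N) × (Fin m ⊕ Fin m)) ((Fin N ⊕ Fin N) × (Fin m ⊕ Fin m)) ℂ)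
    (hUdef : U = ((Real.sqrt 2 : ℝ) : ℂ)⁻¹ •
      ((1 : Matrix ((Fin N ⊕ Fin N) × (Fin m ⊕ Fin m)) ((Fin N ⊕ Fin N) × (Fin m ⊕ Fin m)) ℂ)
        - Complex.I • (Zmat N ⊗ₖ Zmat m))) :
    Uᴴ * U = 1 ∧ Uᵀ = U ∧
    ∀ (X : Matrix (Fin N ⊕ Fin N) (Fin N ⊕ Fin N) ℂ)
      (Y : Matrix (Fin m ⊕ Fin m) (Fin m ⊕ Fin m) ℂ),
      Uᴴ * (dual X ⊗ₖ dual Y) * U = (Uᴴ * (X ⊗ₖ Y) * U)ᵀ := by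
  have hWW : (Zmat N ⊗ₖ Zmat m) * (Zmat N ⊗ₖ Zmat m) = 1 := by
    rw [← Matrix.mul_kronecker_mul, Zmat_sq, Zmat_sq, neg_kron_neg, Matrix.one_kronecker_one]
  have hWT : (Zmat N ⊗ₖ Zmat m)ᵀ = Zmat N ⊗ₖ Zmat m := by
    rw [← Matrix.kroneckerMap_transpose, Zmat_transpose, Zmat_transpose, neg_kron_neg]
  have hWH : (Zmat N ⊗ₖ Zmat m)ᴴ = Zmat N ⊗ₖ Zmat m := by
    rw [Matrix.conjTranspose_kronecker, Zmat_conjTranspose, Zmat_conjTranspose, neg_kron_neg]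
  have hdual : ∀ (X : Matrix (Fin N ⊕ Fin N) (Fin N ⊕ Fin N) ℂ)
      (Y : Matrix (Fin m ⊕ Fin m) (Fin m ⊕ Fin m) ℂ),
      dual X ⊗ₖ dual Y = (Zmat N ⊗ₖ Zmat m) * (X ⊗ₖ Y)ᵀ * (Zmat N ⊗ₖ Zmat m) := by
    intro X Y
    rw [← Matrix.kroneckerMap_transpose, ← Matrix.mul_kronecker_mul, ← Matrix.mul_kronecker_mul]
    simp only [dual, Matrix.neg_mul]
    rw [neg_kron_neg]
  generalize Zmat N ⊗ₖ Zmat m = W at *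
  have hs : ((Real.sqrt 2 : ℝ) : ℂ)⁻¹ * ((Real.sqrt 2 : ℝ) : ℂ)⁻¹ = 2⁻¹ := by
    rw [← mul_inv, ← Complex.ofReal_mul, Real.mul_self_sqrt (by norm_num)]
    norm_num
  have hUT : Uᵀ = U := by
    rw [hUdef]
    simp [hWT]
  have hUH : Uᴴ = ((Real.sqrt 2 : ℝ) : ℂ)⁻¹ • (1 + Complex.I • W) := by
    rw [hUdef]
    simp [Matrix.conjTranspose_smul, hWH, Complex.conj_ofReal]
  have hVT : Uᴴᵀ = Uᴴ := by
    rw [hUH]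
    simp [hWT]
  have h1 : Uᴴ * W = Complex.I • U := by
    rw [hUH, hUdef]
    simp only [Matrix.smul_mul, Matrix.add_mul, hWW, Matrix.one_mul]
    rw [smul_comm Complex.I, smul_sub, smul_smul Complex.I, Complex.I_mul_I]
    congr 1
    module
  have h2 : W * U = (-Complex.I) • Uᴴ := by
    rw [hUH, hUdef]
    simp only [Matrix.mul_smul, Matrix.mul_sub, hWW, Matrix.mul_one]
    rw [smul_comm (-Complex.I), smul_add, smul_smul (-Complex.I), neg_mul, Complex.I_mul_I]
    congr 1
    module
  refine ⟨?_, hUT, ?_⟩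
  · rw [hUH, hUdef]
    have hp : (1 + Complex.I • W) * (1 - Complex.I • W) = (2 : ℂ) • 1 := by
      rw [Matrix.add_mul, Matrix.mul_sub, Matrix.mul_sub, Matrix.smul_mul, Matrix.smul_mul,
        Matrix.mul_smul, Matrix.mul_smul, hWW, Matrix.one_mul, Matrix.one_mul, Matrix.mul_one,
        smul_smul, Complex.I_mul_I]
      module
    rw [Matrix.smul_mul, Matrix.mul_smul, hp, smul_smul, smul_smul, hs]
    norm_num
  · intro X Y
    rw [hdual, Matrix.transpose_mul, Matrix.transpose_mul, hUT, hVT]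
    calc Uᴴ * (W * (X ⊗ₖ Y)ᵀ * W) * U = (Uᴴ * W) * (X ⊗ₖ Y)ᵀ * (W * U) := by
          simp only [Matrix.mul_assoc]
      _ = U * ((X ⊗ₖ Y)ᵀ * Uᴴ) := by
          rw [h1, h2]
          simp [smul_smul, Matrix.mul_assoc]
end

section
/- Let d ≥ 1 and set n′ = d(d+1)/2 + 1. Let γ_1,…,γ_{d+1} ∈ M_k(ℂ) be Hermitian unitary matrices that pairwise anticommute (γ_r γ_s = −γ_s γ_r for r ≠ s), and for Hermitian matrices H_1,…,H_{d+1} ∈ M_n(ℂ) write B(H) := Σ_{r=1}^{d+1} H_r ⊗ γ_r. Suppose H_1,…,H_{d+1} form a δ-representation of the d-sphere with δ < 1/n′, and suppose K_1,…,K_{d+1} ∈ M_n(ℂ) are Hermitian with Σ_{r=1}^{d+1} ‖H_r − K_r‖ < √(1 − n′δ). Then B(H) and B(K) are invertible Hermitian matrices and they have the same signature. -/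
open Matrix
open scoped Kronecker ComplexOrder

/-- The ℓ²→ℓ² operator norm of a complex matrix. -/
noncomputable def opNorm {n : Type*} [Fintype n] [DecidableEq n] (A : Matrix n n ℂ) : ℝ :=
  ‖Matrix.toEuclideanCLM (𝕜 := ℂ) (n := n) A‖

/-- The signature of a Hermitian matrix: the number of positive eigenvalues minus the
number of negative eigenvalues, counted with multiplicity. -/
noncomputable def signature {n : Type*} [Fintype n] [DecidableEq n] {A : Matrix n n ℂ}
    (hA : A.IsHermitian) : ℤ :=
  ((Finset.univ.filter fun i => 0 < hA.eigenvalues i).card : ℤ) -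
  ((Finset.univ.filter fun i => hA.eigenvalues i < 0).card : ℤ)

/-- The Bott matrix `B(H₁, …, H_{d+1}) = Σ_r H_r ⊗ γ_r`. -/
noncomputable def BMat {d n k : ℕ} (H : Fin (d + 1) → Matrix (Fin n) (Fin n) ℂ)
    (γ : Fin (d + 1) → Matrix (Fin k) (Fin k) ℂ) :
    Matrix (Fin n × Fin k) (Fin n × Fin k) ℂ :=
  ∑ r, H r ⊗ₖ γ r

open scoped Matrix.Norms.L2Operator in
theorem opNorm_eq_norm {n : Type*} [Fintype n] [DecidableEq n] (A : Matrix n n ℂ) :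
    opNorm A = ‖A‖ := rfl

/-- Abstract inertia comparison. -/
theorem card_pos_le {E ι : Type*} [NormedAddCommGroup E] [InnerProductSpace ℂ E] [Fintype ι]
    (T S : E →ₗ[ℂ] E) (u v : OrthonormalBasis ι ℂ E) (a b : ι → ℝ) (c e : ℝ) (hec : e < c)
    (hT : ∀ i, T (u i) = (a i : ℂ) • u i) (hS : ∀ i, S (v i) = (b i : ℂ) • v i)
    (ha : ∀ i, 0 < a i → c ≤ a i) (hTS : ∀ x, ‖T x - S x‖ ≤ e * ‖x‖) :
    (Finset.univ.filter fun i => 0 < a i).card ≤ (Finset.univ.filter fun i => 0 < b i).card := by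
  classical
  have quad : ∀ (R : E →ₗ[ℂ] E) (w : OrthonormalBasis ι ℂ E) (l : ι → ℝ)
      (_ : ∀ i, R (w i) = (l i : ℂ) • w i) (x : E),
      (inner ℂ x (R x)).re = ∑ i, l i * ‖inner ℂ (w i) x‖ ^ 2 := by
    intro R w l hR x
    have h1 : R x = ∑ i, (inner ℂ (w i) x * (l i : ℂ)) • w i := by
      conv_lhs => rw [← w.sum_repr' x]
      simp only [map_sum, map_smul, hR, smul_smul]
    rw [h1, inner_sum, Complex.re_sum]
    refine Finset.sum_congr rfl fun i _ => ?_
    rw [inner_smul_right, ← inner_conj_symm x (w i), mul_right_comm, Complex.mul_conj,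
      Complex.normSq_eq_norm_sq, ← Complex.ofReal_mul, Complex.ofReal_re, mul_comm]
  let W : Submodule ℂ E := Submodule.span ℂ (Set.range fun i : {i // 0 < a i} => u i)
  have hW : Module.finrank ℂ W = Fintype.card {i // 0 < a i} :=
    finrank_span_eq_card (u.orthonormal.linearIndependent.comp _ Subtype.val_injective)
  have hperp : ∀ x ∈ W, ∀ j, ¬ 0 < a j → inner ℂ (u j) x = 0 := by
    intro x hx j hj
    induction hx using Submodule.span_induction with
    | mem x hx =>
      obtain ⟨i, rfl⟩ := hx
      refine u.orthonormal.2 ?_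
      rintro rfl
      exact hj i.2
    | zero => simp
    | add x y _ _ hx hy => rw [inner_add_right, hx, hy, add_zero]
    | smul t x _ hx => rw [inner_smul_right, hx, mul_zero]
  let f : W →ₗ[ℂ] ({j // 0 < b j} → ℂ) :=
    (LinearMap.pi fun j : {j // 0 < b j} => ((innerSL ℂ (v j)).toLinearMap)).comp W.subtype
  have hf : Function.Injective f := by
    rw [← LinearMap.ker_eq_bot, LinearMap.ker_eq_bot']
    rintro ⟨x, hx⟩ hfx
    have hv : ∀ j, 0 < b j → inner ℂ (v j) x = 0 := fun j hj => congrFun hfx ⟨j, hj⟩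
    have h1 : c * ‖x‖ ^ 2 ≤ (inner ℂ x (T x)).re := by
      rw [quad T u a hT, ← u.sum_sq_norm_inner_right x, Finset.mul_sum]
      refine Finset.sum_le_sum fun i _ => ?_
      by_cases hi : 0 < a i
      · exact mul_le_mul_of_nonneg_right (ha i hi) (by positivity)
      · simp [hperp x hx i hi]
    have h2 : (inner ℂ x (S x)).re ≤ 0 := by
      rw [quad S v b hS]
      refine Finset.sum_nonpos fun i _ => ?_
      by_cases hi : 0 < b i
      · simp [hv i hi]
      · exact mul_nonpos_of_nonpos_of_nonneg (not_lt.1 hi) (by positivity)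
    have h3 : (inner ℂ x (T x)).re - (inner ℂ x (S x)).re ≤ e * ‖x‖ ^ 2 := by
      rw [← Complex.sub_re, ← inner_sub_right]
      calc _ ≤ ‖inner ℂ x (T x - S x)‖ := Complex.re_le_norm _
        _ ≤ ‖x‖ * ‖T x - S x‖ := norm_inner_le_norm _ _
        _ ≤ ‖x‖ * (e * ‖x‖) := by gcongr; exact hTS x
        _ = _ := by ring
    have h4 : ‖x‖ ^ 2 ≤ 0 := by
      by_contra h
      nlinarith
    have h5 : x = 0 := by
      have : ‖x‖ = 0 := by nlinarith [norm_nonneg x]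
      simpa using this
    simpa using h5
  have := LinearMap.finrank_le_finrank_of_injective hf
  rw [hW, Module.finrank_fintype_fun_eq_card, Fintype.card_subtype, Fintype.card_subtype] at this
  exact this

open scoped Matrix.Norms.L2Operator in
theorem signature_stable {m : Type*} [Fintype m] [DecidableEq m] {A B : Matrix m m ℂ}
    (hA : A.IsHermitian) (hB : B.IsHermitian) (q : ℝ)
    (hAq : ‖A * A - 1‖ ≤ q) (hAB : ‖A - B‖ < Real.sqrt (1 - q)) :
    IsUnit A.det ∧ IsUnit B.det ∧ signature hA = signature hB := by
  have hspos : 0 < Real.sqrt (1 - q) := (norm_nonneg _).trans_lt hAB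
  have hbd : ∀ (M : Matrix m m ℂ) (x : EuclideanSpace ℂ m),
      ‖Matrix.toEuclideanLin M x‖ ≤ ‖M‖ * ‖x‖ := fun M x =>
    (Matrix.toEuclideanCLM (𝕜 := ℂ) (n := m) M).le_opNorm x
  have heig : ∀ {M : Matrix m m ℂ} (hM : M.IsHermitian) i,
      Matrix.toEuclideanLin M (hM.eigenvectorBasis i)
        = (hM.eigenvalues i : ℂ) • hM.eigenvectorBasis i := by
    intro M hM i
    have := hM.mulVec_eigenvectorBasis i
    ext j
    have := congrFun this j
    simpa [Matrix.toEuclideanLin] using this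
  have habs : ∀ i, Real.sqrt (1 - q) ≤ |hA.eigenvalues i| := by
    intro i
    have h1 := hbd (A * A - 1) (hA.eigenvectorBasis i)
    have h2 : Matrix.toEuclideanLin (A * A - 1) (hA.eigenvectorBasis i)
        = ((hA.eigenvalues i ^ 2 - 1 : ℝ) : ℂ) • hA.eigenvectorBasis i := by
      have : Matrix.toEuclideanLin (A * A - 1) (hA.eigenvectorBasis i) =
          Matrix.toEuclideanLin A (Matrix.toEuclideanLin A (hA.eigenvectorBasis i))
            - hA.eigenvectorBasis i := by
        ext j
        simp [Matrix.toEuclideanLin, Matrix.sub_mulVec, Matrix.mulVec_mulVec]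
      rw [this, heig, map_smul, heig, smul_smul]
      push_cast
      rw [sub_smul, one_smul, sq]
    rw [h2, norm_smul, hA.eigenvectorBasis.orthonormal.1 i, mul_one, mul_one,
      Complex.norm_real, Real.norm_eq_abs] at h1
    have h3 := (abs_le.1 (h1.trans hAq)).1
    rw [← Real.sqrt_sq_eq_abs]
    exact Real.sqrt_le_sqrt (by linarith)
  have hsub : ∀ x, Matrix.toEuclideanLin A x - Matrix.toEuclideanLin B x
      = Matrix.toEuclideanLin (A - B) x := fun x => by simp
  have hp := card_pos_le (Matrix.toEuclideanLin A) (Matrix.toEuclideanLin B)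
    hA.eigenvectorBasis hB.eigenvectorBasis hA.eigenvalues hB.eigenvalues _ _ hAB
    (heig hA) (heig hB) (fun i hi => by simpa [abs_of_pos hi] using habs i)
    (fun x => by rw [hsub]; exact hbd _ x)
  have hn := card_pos_le (-Matrix.toEuclideanLin A) (-Matrix.toEuclideanLin B)
    hA.eigenvectorBasis hB.eigenvectorBasis (fun i => -hA.eigenvalues i)
    (fun i => -hB.eigenvalues i) _ _ hAB
    (fun i => by simp [heig hA]) (fun i => by simp [heig hB])
    (fun i hi => by simpa [abs_of_neg (neg_pos.1 hi)] using habs i)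
    (fun x => by
      rw [LinearMap.neg_apply, LinearMap.neg_apply, ← neg_sub', norm_neg, hsub]
      exact hbd _ x)
  simp only [neg_pos] at hn
  have hcount : ∀ l : m → ℝ, (Finset.univ.filter fun i => 0 < l i).card
      + (Finset.univ.filter fun i => l i < 0).card
      + (Finset.univ.filter fun i => l i = 0).card = Fintype.card m := by
    intro l
    rw [← Finset.card_union_of_disjoint, ← Finset.card_union_of_disjoint]
    · rw [← Finset.card_univ]
      congr 1
      ext i
      have := lt_trichotomy 0 (l i)
      simp only [Finset.mem_union, Finset.mem_filter, Finset.mem_univ, true_and, iff_true]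
      grind
    · rw [Finset.disjoint_left]
      intro i
      simp only [Finset.mem_union, Finset.mem_filter, Finset.mem_univ, true_and]
      grind
    · rw [Finset.disjoint_left]
      intro i
      simp only [Finset.mem_filter, Finset.mem_univ, true_and]
      grind
  have hA0 : ∀ i, hA.eigenvalues i ≠ 0 := fun i h => by
    have := habs i
    rw [h, abs_zero] at this
    linarith
  have hAz : (Finset.univ.filter fun i => hA.eigenvalues i = 0).card = 0 := by
    simp [hA0]
  have cA := hcount hA.eigenvalues
  have cB := hcount hB.eigenvalues
  have hBz : (Finset.univ.filter fun i => hB.eigenvalues i = 0).card = 0 := by omega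
  have hB0 : ∀ i, hB.eigenvalues i ≠ 0 := fun i h => by
    rw [Finset.card_eq_zero] at hBz
    exact Finset.notMem_empty i (hBz ▸ Finset.mem_filter.2 ⟨Finset.mem_univ i, h⟩)
  refine ⟨?_, ?_, ?_⟩
  · rw [hA.det_eq_prod_eigenvalues, isUnit_iff_ne_zero, Finset.prod_ne_zero_iff]
    intro i _
    simpa using hA0 i
  · rw [hB.det_eq_prod_eigenvalues, isUnit_iff_ne_zero, Finset.prod_ne_zero_iff]
    intro i _
    simpa using hB0 i
  · unfold signature
    omega

/-- `A ↦ A ⊗ 1` as a star algebra homomorphism. -/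
def kronOneHom (n k : ℕ) :
    Matrix (Fin n) (Fin n) ℂ →⋆ₐ[ℂ] Matrix (Fin n × Fin k) (Fin n × Fin k) ℂ where
  toFun A := A ⊗ₖ (1 : Matrix (Fin k) (Fin k) ℂ)
  map_one' := by simp
  map_mul' A B := by rw [← Matrix.mul_kronecker_mul, one_mul]
  map_zero' := by simp
  map_add' A B := Matrix.add_kronecker _ _ _
  commutes' r := by
    rw [Algebra.algebraMap_eq_smul_one, Algebra.algebraMap_eq_smul_one, Matrix.smul_kronecker,
      Matrix.one_kronecker_one]
  map_star' A := by
    rw [Matrix.star_eq_conjTranspose, Matrix.star_eq_conjTranspose, Matrix.conjTranspose_kronecker,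
      Matrix.conjTranspose_one]

open scoped Matrix.Norms.L2Operator in
theorem norm_kron_le {n k : ℕ} (A : Matrix (Fin n) (Fin n) ℂ) (g : Matrix (Fin k) (Fin k) ℂ)
    (hg : gᴴ * g = 1) : ‖A ⊗ₖ g‖ ≤ ‖A‖ := by
  have h1 : ‖A ⊗ₖ (1 : Matrix (Fin k) (Fin k) ℂ)‖ ≤ ‖A‖ :=
    NonUnitalStarAlgHom.norm_apply_le (kronOneHom n k) A
  have h2 : (A ⊗ₖ g) = (A ⊗ₖ (1 : Matrix (Fin k) (Fin k) ℂ))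
      * ((1 : Matrix (Fin n) (Fin n) ℂ) ⊗ₖ g) := by
    rw [← Matrix.mul_kronecker_mul, one_mul, mul_one]
  set U := (1 : Matrix (Fin n) (Fin n) ℂ) ⊗ₖ g with hU
  have h3 : ‖U‖ ≤ 1 := by
    have h4 : star U * U = 1 := by
      rw [hU, Matrix.star_eq_conjTranspose, Matrix.conjTranspose_kronecker,
        ← Matrix.mul_kronecker_mul, hg, Matrix.conjTranspose_one, one_mul,
        Matrix.one_kronecker_one]
    have h5 := CStarRing.norm_star_mul_self (x := U)
    have h6 : ‖(1 : Matrix (Fin n × Fin k) (Fin n × Fin k) ℂ)‖ ≤ 1 := by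
      rw [← opNorm_eq_norm, opNorm, map_one]
      exact ContinuousLinearMap.norm_id_le
    rw [h4] at h5
    nlinarith [norm_nonneg U]
  rw [h2]
  calc _ ≤ ‖A ⊗ₖ (1 : Matrix (Fin k) (Fin k) ℂ)‖ * ‖U‖ := norm_mul_le _ _
    _ ≤ ‖A‖ * 1 := by gcongr
    _ = _ := mul_one _

theorem BMat_herm {d n k : ℕ} (H : Fin (d + 1) → Matrix (Fin n) (Fin n) ℂ)
    (γ : Fin (d + 1) → Matrix (Fin k) (Fin k) ℂ) (hγ : ∀ r, (γ r)ᴴ = γ r)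
    (hH : ∀ r, (H r)ᴴ = H r) : (BMat H γ).IsHermitian := by
  unfold BMat Matrix.IsHermitian
  rw [Matrix.conjTranspose_sum]
  exact Finset.sum_congr rfl fun r _ => by rw [Matrix.conjTranspose_kronecker, hγ, hH]

theorem two_BMat_sq {d n k : ℕ} (H : Fin (d + 1) → Matrix (Fin n) (Fin n) ℂ)
    (γ : Fin (d + 1) → Matrix (Fin k) (Fin k) ℂ) (hγ2 : ∀ r, γ r * γ r = 1)
    (hγanti : ∀ r s, r ≠ s → γ r * γ s = -(γ s * γ r)) :
    (2 : ℂ) • (BMat H γ * BMat H γ - 1) =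
      (2 : ℂ) • ((∑ r, H r * H r - 1) ⊗ₖ (1 : Matrix (Fin k) (Fin k) ℂ))
      + ∑ r, ∑ s, (H r * H s - H s * H r) ⊗ₖ (γ r * γ s) := by
  have hB : BMat H γ * BMat H γ = ∑ r, ∑ s, (H r * H s) ⊗ₖ (γ r * γ s) := by
    unfold BMat
    rw [Finset.sum_mul_sum]
    simp only [Matrix.mul_kronecker_mul]
  have hB2 : BMat H γ * BMat H γ = ∑ r, ∑ s, (H s * H r) ⊗ₖ (γ s * γ r) := by
    rw [hB, Finset.sum_comm]
  have key : ∀ r s, (H r * H s) ⊗ₖ (γ r * γ s) + (H s * H r) ⊗ₖ (γ s * γ r)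
      = (H r * H s - H s * H r) ⊗ₖ (γ r * γ s)
        + if r = s then (2 : ℂ) • ((H r * H r) ⊗ₖ (1 : Matrix (Fin k) (Fin k) ℂ)) else 0 := by
    intro r s
    split_ifs with h
    · subst h
      rw [hγ2, sub_self, Matrix.zero_kronecker, zero_add, two_smul]
    · rw [hγanti s r (Ne.symm h), add_zero, sub_eq_add_neg, Matrix.add_kronecker]
      congr 1
      ext i j
      simp [Matrix.kroneckerMap_apply]
  have hsum : BMat H γ * BMat H γ + BMat H γ * BMat H γ =
      ∑ r, ∑ s, (H r * H s - H s * H r) ⊗ₖ (γ r * γ s)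
      + (2 : ℂ) • ((∑ r, H r * H r) ⊗ₖ (1 : Matrix (Fin k) (Fin k) ℂ)) := by
    have hk : (∑ r, H r * H r) ⊗ₖ (1 : Matrix (Fin k) (Fin k) ℂ)
        = ∑ r, (H r * H r) ⊗ₖ (1 : Matrix (Fin k) (Fin k) ℂ) :=
      map_sum (kronOneHom n k) (fun r => H r * H r) Finset.univ
    nth_rewrite 1 [hB]
    rw [hB2, hk, Finset.smul_sum]
    simp only [← Finset.sum_add_distrib, key]
    simp [Finset.sum_add_distrib]
  have hs1 : (∑ r, H r * H r - 1) ⊗ₖ (1 : Matrix (Fin k) (Fin k) ℂ)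
      = (∑ r, H r * H r) ⊗ₖ (1 : Matrix (Fin k) (Fin k) ℂ) - 1 := by
    have := map_sub (kronOneHom n k) (∑ r, H r * H r) 1
    rw [map_one] at this
    exact this
  rw [hs1, smul_sub, two_smul, hsum, smul_sub]
  abel

open scoped Matrix.Norms.L2Operator in
theorem bott_aux (d n k : ℕ) (hd : 1 ≤ d) (δ : ℝ)
    (γ : Fin (d + 1) → Matrix (Fin k) (Fin k) ℂ)
    (hγherm : ∀ r, (γ r)ᴴ = γ r)
    (hγunit : ∀ r, (γ r)ᴴ * γ r = 1)
    (hγanti : ∀ r s, r ≠ s → γ r * γ s = -(γ s * γ r))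
    (H K : Fin (d + 1) → Matrix (Fin n) (Fin n) ℂ)
    (hHherm : ∀ r, (H r)ᴴ = H r) (hKherm : ∀ r, (K r)ᴴ = K r)
    (hδ : δ < 1 / ((d * (d + 1) : ℝ) / 2 + 1))
    (hsq : opNorm (∑ r, H r * H r - 1) ≤ δ)
    (hcomm : ∀ r s, r ≠ s → opNorm (H r * H s - H s * H r) ≤ δ)
    (hclose : ∑ r, opNorm (H r - K r) < Real.sqrt (1 - ((d * (d + 1) : ℝ) / 2 + 1) * δ)) :
    ∃ (hBH : (BMat H γ).IsHermitian) (hBK : (BMat K γ).IsHermitian),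
      IsUnit (BMat H γ).det ∧ IsUnit (BMat K γ).det ∧ signature hBH = signature hBK := by
  have hγ2 : ∀ r, γ r * γ r = 1 := fun r => by
    have := hγunit r
    rwa [hγherm r] at this
  have hBH := BMat_herm H γ hγherm hHherm
  have hBK := BMat_herm K γ hγherm hKherm
  refine ⟨hBH, hBK, signature_stable hBH hBK (((d * (d + 1) : ℝ) / 2 + 1) * δ) ?_ ?_⟩
  · have h2 := two_BMat_sq H γ hγ2 hγanti
    have hGs : ∀ r s, ‖(H r * H s - H s * H r) ⊗ₖ (γ r * γ s)‖ ≤ if s = r then 0 else δ := by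
      intro r s
      split_ifs with h
      · subst h
        rw [sub_self, Matrix.zero_kronecker, norm_zero]
      · refine (norm_kron_le _ _ ?_).trans (hcomm r s (Ne.symm h))
        rw [Matrix.conjTranspose_mul, mul_assoc, ← mul_assoc (γ r)ᴴ, hγunit, one_mul, hγunit]
    have hrow : ∀ r, ‖∑ s, (H r * H s - H s * H r) ⊗ₖ (γ r * γ s)‖ ≤ d * δ := by
      intro r
      refine (norm_sum_le _ _).trans ((Finset.sum_le_sum fun s _ => hGs r s).trans ?_)
      rw [← Finset.add_sum_erase _ _ (Finset.mem_univ r), if_pos rfl, zero_add,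
        Finset.sum_congr rfl (fun s hs => if_neg (Finset.ne_of_mem_erase hs)),
        Finset.sum_const, Finset.card_erase_of_mem (Finset.mem_univ r)]
      simp
    have hall : ‖∑ r, ∑ s, (H r * H s - H s * H r) ⊗ₖ (γ r * γ s)‖ ≤ (d + 1) * (d * δ) := by
      refine (norm_sum_le _ _).trans ((Finset.sum_le_sum fun r _ => hrow r).trans ?_)
      simp
    have hone : ‖(∑ r, H r * H r - 1) ⊗ₖ (1 : Matrix (Fin k) (Fin k) ℂ)‖ ≤ δ :=
      (norm_kron_le _ _ (by simp)).trans hsq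
    have h3 := congrArg norm h2
    rw [norm_smul] at h3
    have h4 := norm_add_le
      ((2 : ℂ) • ((∑ r, H r * H r - 1) ⊗ₖ (1 : Matrix (Fin k) (Fin k) ℂ)))
      (∑ r, ∑ s, (H r * H s - H s * H r) ⊗ₖ (γ r * γ s))
    rw [← h3, norm_smul, Complex.norm_ofNat] at h4
    linarith
  · refine lt_of_le_of_lt ?_ hclose
    have : BMat H γ - BMat K γ = ∑ r, (H r - K r) ⊗ₖ γ r := by
      unfold BMat
      rw [← Finset.sum_sub_distrib]
      refine Finset.sum_congr rfl fun r _ => ?_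
      ext i j
      simp [Matrix.kroneckerMap_apply, sub_mul]
    rw [this]
    exact (norm_sum_le _ _).trans (Finset.sum_le_sum fun r _ => norm_kron_le _ _ (hγunit r))

/-- if `(H_r)` is a `δ`-representation of the `d`-sphere with `δ < 1/n′`,
`n′ = d(d+1)/2 + 1`, and `(K_r)` are Hermitian matrices with `Σ_r ‖H_r - K_r‖ < √(1 - n′ δ)`,
then the Bott matrices `B(H)` and `B(K)` are invertible Hermitian matrices with the
same signature. -/
theorem bott_index_stable (d n k : ℕ) (hd : 1 ≤ d) (δ : ℝ)
    (γ : Fin (d + 1) → Matrix (Fin k) (Fin k) ℂ)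
    (hγherm : ∀ r, (γ r)ᴴ = γ r)
    (hγunit : ∀ r, (γ r)ᴴ * γ r = 1)
    (hγanti : ∀ r s, r ≠ s → γ r * γ s = -(γ s * γ r))
    (H K : Fin (d + 1) → Matrix (Fin n) (Fin n) ℂ)
    (hHherm : ∀ r, (H r)ᴴ = H r) (hKherm : ∀ r, (K r)ᴴ = K r)
    (hδ : δ < 1 / ((d * (d + 1) : ℝ) / 2 + 1))
    (hsq : opNorm (∑ r, H r * H r - 1) ≤ δ)
    (hcomm : ∀ r s, r ≠ s → opNorm (H r * H s - H s * H r) ≤ δ)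
    (hclose : ∑ r, opNorm (H r - K r) < Real.sqrt (1 - ((d * (d + 1) : ℝ) / 2 + 1) * δ)) :
    ∃ (hBH : (BMat H γ).IsHermitian) (hBK : (BMat K γ).IsHermitian),
      IsUnit (BMat H γ).det ∧ IsUnit (BMat K γ).det ∧ signature hBH = signature hBK := by
  exact bott_aux d n k hd δ γ hγherm hγunit hγanti H K hHherm hKherm hδ hsq hcomm hclose
end

section
/- Let d ≥ 1 and let γ_1,…,γ_{d+1} ∈ M_k(ℂ) be Hermitian unitary matrices that pairwise anticommute (γ_r γ_s = −γ_s γ_r for r ≠ s). If H_1,…,H_{d+1} ∈ M_n(ℂ) are pairwise commuting Hermitian matrices such that B := Σ_{r=1}^{d+1} H_r ⊗ γ_r is invertible, then the signature of the Hermitian matrix B is 0. -/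
open Matrix
open scoped Kronecker ComplexOrder

lemma trace_pow_herm {n : Type*} [Fintype n] [DecidableEq n] {A : Matrix n n ℂ}
    (hA : A.IsHermitian) (m : ℕ) :
    (A ^ m).trace = ((∑ i, hA.eigenvalues i ^ m : ℝ) : ℂ) := by
  conv_lhs => rw [hA.spectral_theorem]
  rw [← map_pow, Unitary.conjStarAlgAut_apply, Matrix.trace_mul_cycle]
  simp [Matrix.diagonal_pow, Matrix.trace_diagonal]

lemma signature_zero_of_odd {n : Type*} [Fintype n] [DecidableEq n] {A : Matrix n n ℂ}
    (hA : A.IsHermitian) (h : ∀ m : ℕ, (A ^ (2 * m + 1)).trace = 0) :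
    signature hA = 0 := by
  have h1 : ∀ m : ℕ, ∑ i, hA.eigenvalues i ^ (2 * m + 1) = 0 := by
    intro m
    have := h m
    rw [trace_pow_herm hA] at this
    exact_mod_cast this
  have h2 : ∀ p : Polynomial ℝ,
      ∑ i, hA.eigenvalues i * p.eval (hA.eigenvalues i ^ 2) = 0 := by
    intro p
    simp_rw [Polynomial.eval_eq_sum_range, Finset.mul_sum]
    rw [Finset.sum_comm]
    refine Finset.sum_eq_zero fun j _ => ?_
    have h3 : ∀ i, hA.eigenvalues i * (p.coeff j * (hA.eigenvalues i ^ 2) ^ j)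
        = p.coeff j * hA.eigenvalues i ^ (2 * j + 1) := by
      intro i
      rw [← pow_mul]; ring
    simp_rw [h3]
    rw [← Finset.mul_sum, h1, mul_zero]
  have h4 := h2 (Lagrange.interpolate (Finset.univ.image fun i => hA.eigenvalues i ^ 2) id
    (fun x => 1 / Real.sqrt x))
  have h5 : ∀ i, hA.eigenvalues i * (Lagrange.interpolate
      (Finset.univ.image fun i => hA.eigenvalues i ^ 2) id
      (fun x => 1 / Real.sqrt x)).eval (hA.eigenvalues i ^ 2) =
      (if 0 < hA.eigenvalues i then 1 else 0) - (if hA.eigenvalues i < 0 then 1 else 0) := by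
    intro i
    have h6 := Lagrange.eval_interpolate_at_node
      (s := Finset.univ.image fun i => hA.eigenvalues i ^ 2) (v := id)
      (fun x => 1 / Real.sqrt x) (Function.injective_id.injOn)
      (Finset.mem_image_of_mem (fun i => hA.eigenvalues i ^ 2) (Finset.mem_univ i))
    simp only [id] at h6
    erw [h6]
    rw [Real.sqrt_sq_eq_abs]
    rcases lt_trichotomy (hA.eigenvalues i) 0 with hl | hl | hl
    · rw [abs_of_neg hl, if_neg hl.not_gt, if_pos hl]
      have hne := hl.ne
      field_simp
      norm_num
    · simp [hl]
    · rw [abs_of_pos hl, if_neg hl.not_gt, if_pos hl]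
      have hne := hl.ne.symm
      field_simp
      norm_num
  simp_rw [h5] at h4
  rw [Finset.sum_sub_distrib, Finset.sum_boole, Finset.sum_boole] at h4
  unfold signature
  exact_mod_cast h4

/-- if `H₁, …, H_{d+1}` are pairwise commuting Hermitian matrices such that
`B = Σ_r H_r ⊗ γ_r` is invertible (where the `γ_r` are pairwise anticommuting Hermitian
unitaries), then the signature of the Hermitian matrix `B` is `0`. -/
theorem bott_of_commuting_eq_zero (d n k : ℕ) (hd : 1 ≤ d)
    (γ : Fin (d + 1) → Matrix (Fin k) (Fin k) ℂ)
    (hγherm : ∀ r, (γ r)ᴴ = γ r)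
    (hγunit : ∀ r, (γ r)ᴴ * γ r = 1)
    (hγanti : ∀ r s, r ≠ s → γ r * γ s = -(γ s * γ r))
    (H : Fin (d + 1) → Matrix (Fin n) (Fin n) ℂ)
    (hHherm : ∀ r, (H r)ᴴ = H r)
    (hHcomm : ∀ r s, H r * H s = H s * H r)
    (hinv : IsUnit (BMat H γ).det) :
    ∃ hB : (BMat H γ).IsHermitian, signature hB = 0 := by
  have hB : (BMat H γ).IsHermitian := by
    unfold Matrix.IsHermitian BMat
    rw [Matrix.conjTranspose_sum]
    refine Finset.sum_congr rfl fun r _ => ?_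
    rw [Matrix.conjTranspose_kronecker, hHherm, hγherm]
  refine ⟨hB, signature_zero_of_odd hB ?_⟩
  have hsq : ∀ r, γ r * γ r = 1 := fun r => by
    have := hγunit r
    rwa [hγherm] at this
  have htr : ∀ r, (γ r).trace = 0 := by
    intro r
    haveI : Nontrivial (Fin (d + 1)) := Fin.nontrivial_iff_two_le.mpr (by omega)
    obtain ⟨s, hs⟩ := exists_ne r
    have h1 : (γ s * (γ r * γ s)).trace = (γ r).trace := by
      rw [Matrix.trace_mul_comm, mul_assoc, hsq, mul_one]
    rw [hγanti r s hs.symm, mul_neg, ← mul_assoc, hsq, one_mul, Matrix.trace_neg] at h1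
    exact self_eq_neg.mp h1.symm
  have hBB : BMat H γ * BMat H γ = (∑ r, H r * H r) ⊗ₖ (1 : Matrix (Fin k) (Fin k) ℂ) := by
    have e1 : BMat H γ * BMat H γ = ∑ r, ∑ s, (H r * H s) ⊗ₖ (γ r * γ s) := by
      unfold BMat
      simp_rw [Finset.sum_mul_sum, Matrix.mul_kronecker_mul]
    have e2 : BMat H γ * BMat H γ = ∑ r, ∑ s, (H r * H s) ⊗ₖ (γ s * γ r) := by
      rw [e1, Finset.sum_comm]
      refine Finset.sum_congr rfl fun r _ => Finset.sum_congr rfl fun s _ => ?_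
      rw [hHcomm]
    have e3 : (2 : ℂ) • (BMat H γ * BMat H γ) =
        (2 : ℂ) • ((∑ r, H r * H r) ⊗ₖ (1 : Matrix (Fin k) (Fin k) ℂ)) := by
      rw [two_smul]
      nth_rewrite 1 [e1]
      rw [e2, ← Finset.sum_add_distrib]
      have e4 : (∑ r, H r * H r) ⊗ₖ (1 : Matrix (Fin k) (Fin k) ℂ)
          = ∑ r, (H r * H r) ⊗ₖ (1 : Matrix (Fin k) (Fin k) ℂ) := by
        ext i j
        simp [Matrix.kroneckerMap_apply, Matrix.sum_apply, Finset.sum_mul]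
      rw [e4, Finset.smul_sum]
      refine Finset.sum_congr rfl fun r _ => ?_
      rw [← Finset.sum_add_distrib, Finset.sum_eq_single r]
      · rw [hsq, two_smul]
      · intro s _ hs
        rw [← Matrix.kronecker_add, hγanti s r hs]
        simp
      · simp
    exact smul_right_injective _ (two_ne_zero) e3
  intro m
  have hpow : (BMat H γ * BMat H γ) ^ m =
      ((∑ r, H r * H r) ^ m) ⊗ₖ (1 : Matrix (Fin k) (Fin k) ℂ) := by
    rw [hBB]
    induction m with
    | zero => simp
    | succ m ih => rw [pow_succ, ih, ← Matrix.mul_kronecker_mul, one_mul, pow_succ]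
  rw [pow_succ, pow_mul, pow_two, hpow]
  unfold BMat
  rw [Finset.mul_sum, Matrix.trace_sum]
  refine Finset.sum_eq_zero fun r _ => ?_
  rw [← Matrix.mul_kronecker_mul, one_mul, Matrix.trace_kronecker, htr, mul_zero]
end

section
/- Let X ∈ M_{2N}(ℂ) be the block matrix [[A, C],[0, D]] with N×N blocks A, C, D. If X is self-dual and normal (X X† = X† X), then A is normal, D = Aᵀ, and C = 0. -/
open Matrix
open scoped Kronecker ComplexOrder

/-- if the block upper-triangular matrix `X = [[A, C],[0, D]]` is self-dual
and normal, then `A` is normal, `D = Aᵀ` and `C = 0`. -/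
theorem selfdual_normal_block_triangular (N : ℕ) (A C D : Matrix (Fin N) (Fin N) ℂ)
    (hdual : dual (Matrix.fromBlocks A C 0 D) = Matrix.fromBlocks A C 0 D)
    (hnormal : Matrix.fromBlocks A C 0 D * (Matrix.fromBlocks A C 0 D)ᴴ =
      (Matrix.fromBlocks A C 0 D)ᴴ * Matrix.fromBlocks A C 0 D) :
    A * Aᴴ = Aᴴ * A ∧ D = Aᵀ ∧ C = 0 := by
  simp only [dual, Zmat, Matrix.fromBlocks_transpose, Matrix.fromBlocks_neg,
    Matrix.fromBlocks_multiply, Matrix.fromBlocks_inj] at hdual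
  simp only [Matrix.fromBlocks_conjTranspose, Matrix.fromBlocks_multiply,
    Matrix.fromBlocks_inj] at hnormal
  obtain ⟨-, -, -, hD⟩ := hdual
  obtain ⟨h11, -, -, -⟩ := hnormal
  simp at hD h11
  have hC : C = 0 := by
    have ht := congrArg Matrix.trace h11
    rw [Matrix.trace_add, Matrix.trace_mul_comm A, add_eq_left] at ht
    exact Matrix.trace_mul_conjTranspose_self_eq_zero_iff.mp ht
  subst hC
  refine ⟨by simpa using h11, hD.symm, rfl⟩
end

section
/- Let X ∈ M_{2N}(ℝ) be a real skew-symmetric matrix (Xᵀ = −X). Then there exist a real orthogonal matrix U ∈ M_{2N}(ℝ) and real numbers a_1,…,a_N such that X = U D Uᵀ, where D is the block-diagonal matrix whose j-th 2×2 diagonal block is [[0, a_j],[−a_j, 0]] for j = 1,…,N and all other entries are zero. -/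
open Matrix

/-- Orthonormal canonical family for a skew operator. -/
theorem skew_family (N : ℕ) : ∀ (E : Type) [NormedAddCommGroup E] [InnerProductSpace ℝ E]
    [FiniteDimensional ℝ E] (T : E →ₗ[ℝ] E), (∀ x y, inner ℝ (T x) y = - inner ℝ x (T y)) →
    Module.finrank ℝ E = 2 * N →
    ∃ (b : Fin 2 × Fin N → E) (a : Fin N → ℝ), Orthonormal ℝ b ∧
      ∀ j, T (b (0, j)) = -(a j) • b (1, j) ∧ T (b (1, j)) = a j • b (0, j) := by
  induction N with
  | zero =>
    intro E _ _ _ T hT hE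
    refine ⟨fun p => p.2.elim0, fun j => j.elim0, ?_, fun j => j.elim0⟩
    exact ⟨fun p => p.2.elim0, fun p => p.2.elim0⟩
  | succ N ih =>
    intro E _ _ _ T hT hE
    by_cases hT0 : T = 0
    · let e : Fin (2 * (N + 1)) ≃ Fin 2 × Fin (N + 1) := finProdFinEquiv.symm
      let b := ((stdOrthonormalBasis ℝ E).reindex (finCongr hE)).reindex e
      exact ⟨b, 0, b.orthonormal, by simp [hT0]⟩
    have hS : (T ∘ₗ T).IsSymmetric := by
      intro x y
      simp [hT]
    obtain ⟨v, μ, hv1, hvS, hTv⟩ : ∃ (v : E) (μ : ℝ), ‖v‖ = 1 ∧ T (T v) = μ • v ∧ T v ≠ 0 := by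
      by_contra! hcon
      apply hT0
      refine (hS.eigenvectorBasis rfl).toBasis.ext fun i => ?_
      have := hcon (hS.eigenvectorBasis rfl i) (hS.eigenvalues rfl i)
        ((hS.eigenvectorBasis rfl).orthonormal.1 i)
        (hS.apply_eigenvectorBasis rfl i)
      simpa using this
    set c : ℝ := ‖T v‖ with hc
    have hc0 : c ≠ 0 := by simpa [hc] using hTv
    have hvv : inner ℝ v v = (1 : ℝ) := by simp [hv1]
    have hμ : μ = - c ^ 2 := by
      have h1 := hT (T v) v
      rw [hvS, inner_smul_left, hvv, real_inner_self_eq_norm_sq] at h1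
      simpa using h1
    have hvTv : inner ℝ v (T v) = (0 : ℝ) := by
      have h1 := hT v v
      rw [real_inner_comm] at h1
      linarith
    set w : E := c⁻¹ • T v with hw
    have hTvw : T v = c • w := by rw [hw, smul_smul, mul_inv_cancel₀ hc0, one_smul]
    have hTw : T w = -c • v := by
      rw [hw, map_smul, hvS, smul_smul, hμ]
      congr 1
      field_simp
    have hww : inner ℝ w w = (1 : ℝ) := by
      rw [hw, inner_smul_left, inner_smul_right, real_inner_self_eq_norm_sq, ← hc]
      simp
      field_simp
    have hw1 : ‖w‖ = 1 := by
      rw [real_inner_self_eq_norm_sq] at hww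
      nlinarith [norm_nonneg w]
    have hvw : inner ℝ v w = (0 : ℝ) := by
      rw [hw, inner_smul_right, hvTv, mul_zero]
    have hwv : inner ℝ w v = (0 : ℝ) := by rw [real_inner_comm, hvw]
    have hon : Orthonormal ℝ ![v, w] := by
      constructor
      · intro i
        fin_cases i <;> simp [hv1, hw1]
      · intro i j hij
        fin_cases i <;> fin_cases j <;> first | exact absurd rfl hij | exact hvw | exact hwv
    let P : Submodule ℝ E := Submodule.span ℝ (Set.range ![v, w])
    have hP : Module.finrank ℝ P = 2 := by
      simpa using finrank_span_eq_card hon.linearIndependent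
    have hK : Module.finrank ℝ Pᗮ = 2 * N := by
      have := P.finrank_add_finrank_orthogonal
      omega
    have hmem : ∀ x, x ∈ Pᗮ ↔ inner ℝ v x = (0 : ℝ) ∧ inner ℝ w x = (0 : ℝ) := by
      intro x
      constructor
      · intro hx
        rw [Submodule.mem_orthogonal] at hx
        exact ⟨hx v (Submodule.subset_span ⟨0, rfl⟩), hx w (Submodule.subset_span ⟨1, rfl⟩)⟩
      · rintro ⟨h1, h2⟩
        rw [Submodule.mem_orthogonal]
        intro u hu
        induction hu using Submodule.span_induction with
        | mem u hu =>
          obtain ⟨i, rfl⟩ := hu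
          fin_cases i
          · exact h1
          · exact h2
        | zero => simp
        | add x y _ _ hx hy => rw [inner_add_left, hx, hy, add_zero]
        | smul r x _ hx => rw [inner_smul_left, hx, mul_zero]
    have hinv : ∀ x ∈ Pᗮ, T x ∈ Pᗮ := by
      intro x hx
      rw [hmem] at hx ⊢
      have h1 := hT v x
      have h2 := hT w x
      rw [hTvw, inner_smul_left, hx.2] at h1
      rw [hTw, inner_smul_left, hx.1] at h2
      constructor <;> linarith
    obtain ⟨b, a, hb, hba⟩ := ih Pᗮ (T.restrict hinv) (fun x y => hT x y) hK
    refine ⟨fun p => Fin.cons (α := fun _ => E) (![v, w] p.1) (fun j => (b (p.1, j) : E)) p.2,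
      Fin.cons (-c) a, ?_, ?_⟩
    · have hb1 : ∀ p, inner ℝ v (b p : E) = (0 : ℝ) := fun p => ((hmem _).1 (b p).2).1
      have hb2 : ∀ p, inner ℝ w (b p : E) = (0 : ℝ) := fun p => ((hmem _).1 (b p).2).2
      have hb3 : ∀ i p, inner ℝ (![v, w] i) (b p : E) = (0 : ℝ) := by
        intro i p
        fin_cases i
        · exact hb1 p
        · exact hb2 p
      rw [orthonormal_iff_ite] at hb hon ⊢
      rintro ⟨i, j⟩ ⟨k, l⟩
      refine Fin.cases ?_ (fun j => ?_) j <;> refine Fin.cases ?_ (fun l => ?_) l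
      · simpa using hon i k
      · have := hb3 i (k, l)
        simpa [(Fin.succ_ne_zero l).symm] using this
      · have := hb3 k (i, j)
        rw [real_inner_comm] at this
        simpa [Fin.succ_ne_zero j] using this
      · simpa using hb (i, j) (k, l)
    · intro j
      refine Fin.cases ?_ (fun j => ?_) j
      · simpa [hTvw] using hTw
      · have h1 := congrArg Subtype.val (hba j).1
        have h2 := congrArg Subtype.val (hba j).2
        exact ⟨by simpa using h1, by simpa using h2⟩

/-- a real skew-symmetric matrix `X ∈ M_{2N}(ℝ)` can be written as
`X = U D Uᵀ` with `U` real orthogonal and `D` block diagonal with 2×2 diagonal blocks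
`[[0, a_j],[-a_j, 0]]`. -/
theorem real_skew_symmetric_canonical_form (N : ℕ)
    (X : Matrix (Fin 2 × Fin N) (Fin 2 × Fin N) ℝ)
    (hX : Xᵀ = -X) :
    ∃ (U : Matrix (Fin 2 × Fin N) (Fin 2 × Fin N) ℝ) (a : Fin N → ℝ),
      Uᵀ * U = 1 ∧
      X = U * Matrix.blockDiagonal (fun j => !![0, a j; -(a j), 0]) * Uᵀ := by
  obtain ⟨b, a, hb, hba⟩ := skew_family N (EuclideanSpace ℝ (Fin 2 × Fin N))
    (Matrix.toEuclideanLin X) (by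
      intro x y
      simp only [EuclideanSpace.inner_eq_star_dotProduct, star_trivial,
        Matrix.ofLp_toLpLin, Matrix.toLin'_apply]
      rw [Matrix.dotProduct_mulVec, ← Matrix.mulVec_transpose, hX, Matrix.neg_mulVec,
        neg_dotProduct]) (by simp)
  let U : Matrix (Fin 2 × Fin N) (Fin 2 × Fin N) ℝ := Matrix.of fun p q => b q p
  have hU : Uᵀ * U = 1 := by
    ext p q
    rw [orthonormal_iff_ite] at hb
    have := hb p q
    rw [EuclideanSpace.inner_eq_star_dotProduct, star_trivial, dotProduct_comm] at this
    rw [Matrix.one_apply, ← this]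
    rfl
  have hU' : U * Uᵀ = 1 := mul_eq_one_comm.1 hU
  refine ⟨U, a, hU, ?_⟩
  have hXU : X * U = U * Matrix.blockDiagonal (fun j => !![0, a j; -(a j), 0]) := by
    ext p ⟨i, j⟩
    have h1 := congrArg (fun x : EuclideanSpace ℝ (Fin 2 × Fin N) => x p) (hba j).1
    have h2 := congrArg (fun x : EuclideanSpace ℝ (Fin 2 × Fin N) => x p) (hba j).2
    have key : (X * U) p (i, j) = (Matrix.toEuclideanLin X (b (i, j))) p := rfl
    rw [key, Matrix.mul_apply, Fintype.sum_prod_type]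
    fin_cases i
    · simpa [Matrix.blockDiagonal_apply, U, mul_comm] using h1
    · simpa [Matrix.blockDiagonal_apply, U, mul_comm] using h2
  rw [← hXU, Matrix.mul_assoc, hU', Matrix.mul_one]
end
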